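/- arXiv:1004.1495 — 3 statements merged into one kernel-verified Lean document; each statement's English description precedes it below -/
import Mathlib

section
/- Let S be a commutative ring, M an S-module, ι a type, and φ : M → (ι →₀ S) an S-linear map into the free S-module with basis ι. Let I ⊆ S be the ideal generated by all coordinates (φ m) i, for m ∈ M and i ∈ ι. Then for every commutative S-algebra T, the base-changed linear map φ_T : T ⊗[S] M → T ⊗[S] (ι →₀ S) is the zero map if and only if I is contained in the kernel of the structure map algebraMap S T. -/
open TensorProduct

/-- Affine core of the relative zero scheme (Lemma 2.2(1)): for an `S`-linear map
`φ : M → (ι →₀ S)` into a free module, the base change of `φ` to a commutative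
`S`-algebra `T` vanishes iff the ideal of coordinates of `φ` is contained in the
kernel of `algebraMap S T`. -/
theorem baseChange_eq_zero_iff_coordinate_ideal_le_ker
    {S : Type*} [CommRing S] {M : Type*} [AddCommGroup M] [Module S M]
    {ι : Type*} (φ : M →ₗ[S] (ι →₀ S)) :
    ∀ (T : Type*) [CommRing T] [Algebra S T],
      LinearMap.baseChange T φ = 0 ↔
        Ideal.span {s : S | ∃ (m : M) (i : ι), φ m i = s} ≤
          RingHom.ker (algebraMap S T) := by
  intro T _ _
  classical
  rw [Ideal.span_le]
  constructor
  · rintro h s ⟨m, i, rfl⟩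
    have h1 : (1 : T) ⊗ₜ[S] φ m = 0 := by
      have h0 := LinearMap.congr_fun h ((1 : T) ⊗ₜ[S] m)
      rwa [LinearMap.baseChange_tmul, LinearMap.zero_apply] at h0
    have h2 := TensorProduct.finsuppScalarRight_apply_tmul_apply
      (R := S) (S := S) (1 : T) (φ m) i
    rw [h1, map_zero, Finsupp.zero_apply] at h2
    change algebraMap S T (φ m i) = 0
    rw [Algebra.algebraMap_eq_smul_one, ← h2]
  · intro h
    apply LinearMap.ext
    intro x
    rw [LinearMap.zero_apply]
    induction x using TensorProduct.induction_on with
    | zero => exact map_zero _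
    | add x y hx hy => rw [map_add, hx, hy, add_zero]
    | tmul t m =>
      rw [LinearMap.baseChange_tmul]
      apply (TensorProduct.finsuppScalarRight S S T ι).injective
      rw [map_zero]
      ext i
      have h3 : algebraMap S T (φ m i) = 0 := h ⟨m, i, rfl⟩
      rw [TensorProduct.finsuppScalarRight_apply_tmul_apply, Algebra.smul_def, h3, zero_mul,
        Finsupp.zero_apply]
end

section
/- Let R be a commutative Artinian local ring with maximal ideal m, and suppose that the socle of R, i.e. the annihilator ideal (0 : m) = {x ∈ R : x·m = 0}, is a simple R-module. Then every ideal I of R whose length as an R-module equals 2 is a principal ideal. -/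
/-- Local case of Lemma 3.8: in a commutative Artinian local ring `R` whose socle
`(0 : m) = {x | x·m = 0}` is a simple `R`-module (i.e. `R` is Gorenstein), every
ideal of length `2` (length = supremum of lengths of chains of submodules, i.e. the
Krull dimension of the submodule lattice) is principal. -/
theorem ideal_length_two_isPrincipal_of_isSimpleModule_socle
    {R : Type*} [CommRing R] [IsArtinianRing R] [IsLocalRing R]
    (hsoc : IsSimpleModule R
      ↥(Submodule.colon (⊥ : Ideal R) (IsLocalRing.maximalIdeal R)))
    (I : Ideal R) (hI : Order.krullDim (Submodule R ↥I) = 2) :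
    Submodule.IsPrincipal I := by
  have hI2 : Order.height I = 2 := by
    rw [← Module.length_submodule]
    rw [← Module.coe_length] at hI
    exact WithBot.coe_injective hI
  have hS : Order.height (Submodule.colon (⊥ : Ideal R)
      (IsLocalRing.maximalIdeal R : Set R)) = 1 := by
    rw [← Module.length_submodule]
    exact Module.length_eq_one R _
  have hnot : ¬ I ≤ Submodule.colon (⊥ : Ideal R) (IsLocalRing.maximalIdeal R : Set R) := by
    intro h
    have h2 := Order.height_mono h
    rw [hI2, hS] at h2
    exact absurd h2 (by decide)
  obtain ⟨x, hxI, hxS⟩ := SetLike.not_le_iff_exists.mp hnot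
  refine ⟨x, ?_⟩
  by_contra hne
  have hlt : Submodule.span R {x} < I :=
    lt_of_le_of_ne ((Submodule.span_singleton_le_iff_mem x I).2 hxI) (Ne.symm hne)
  have h1 := Submodule.height_strictMono hlt
  rw [hI2] at h1
  apply hxS
  rw [Submodule.mem_colon]
  intro r hr
  have hlt2 : Submodule.span R {r * x} < Submodule.span R {x} ∨ x = 0 := by
    by_cases hx : x ∈ Submodule.span R {r * x}
    · right
      obtain ⟨s, hs⟩ := Submodule.mem_span_singleton.1 hx
      have hu : IsUnit (1 - s * r) := by
        by_contra hn
        have hm : 1 - s * r ∈ IsLocalRing.maximalIdeal R := hn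
        have := Ideal.add_mem _ hm (Ideal.mul_mem_left _ s hr)
        rw [sub_add_cancel] at this
        exact (IsLocalRing.mem_maximalIdeal _).1 this isUnit_one
      apply hu.mul_right_eq_zero.1
      rw [smul_eq_mul] at hs
      linear_combination -hs
    · left
      refine lt_of_le_of_ne ?_ ?_
      · rw [Submodule.span_singleton_le_iff_mem]
        exact Submodule.mem_span_singleton.2 ⟨r, rfl⟩
      · intro h
        exact hx (h ▸ Submodule.mem_span_singleton_self x)
  rcases hlt2 with h | h
  · have h3 := Submodule.height_strictMono h
    have h4 : Order.height (Submodule.span R {r * x}) = 0 := by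
      have h5 : Order.height (Submodule.span R {x}) ≤ 1 := by
        apply Order.le_of_lt_add_one
        exact lt_of_lt_of_eq h1 (by norm_num)
      exact Order.lt_one_iff.1 (lt_of_lt_of_le h3 h5)
    have h6 := Order.height_eq_zero.1 h4
    rw [isMin_iff_eq_bot, Submodule.span_singleton_eq_bot] at h6
    simp [mul_comm x r, h6]
  · simp [h]
end

section
/- Let A be a commutative Artinian ring such that for every maximal ideal m of A, the socle of the localization A_m — the annihilator ideal of the maximal ideal of A_m — is a simple A_m-module. Then every ideal I of A whose length as an A-module equals 2 is a principal ideal. -/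
/-- In a module of length two, a cyclic proper submodule has no proper nonzero submodule. -/
theorem aux_chain {A M : Type*} [CommRing A] [AddCommGroup M] [Module A M]
    (hI : Order.krullDim (Submodule A M) = 2) (x : M)
    (hx : Submodule.span A {x} ≠ ⊤) (a : A) (ha : a • x ≠ 0) : ∃ r : A, r • a • x = x := by
  by_contra hcon
  have h1 : (⊥ : Submodule A M) < Submodule.span A {a • x} := by
    rw [bot_lt_iff_ne_bot, Ne, Submodule.span_singleton_eq_bot]
    exact ha
  have h2 : Submodule.span A {a • x} < Submodule.span A {x} := by
    refine lt_of_le_of_ne ?_ ?_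
    · rw [Submodule.span_singleton_le_iff_mem]
      exact Submodule.smul_mem _ _ (Submodule.mem_span_singleton_self x)
    · intro he
      have := Submodule.mem_span_singleton_self (R := A) x
      rw [← he, Submodule.mem_span_singleton] at this
      exact hcon this
  have h3 : Submodule.span A {x} < ⊤ := lt_top_iff_ne_top.mpr hx
  let s : LTSeries (Submodule A M) :=
    { length := 3
      toFun := ![⊥, Submodule.span A {a • x}, Submodule.span A {x}, ⊤]
      step := by
        intro i
        fin_cases i
        · exact h1
        · exact h2
        · exact h3 }
  have hs : s.length = 3 := rfl
  have := Order.LTSeries.length_le_krullDim s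
  rw [hI, hs] at this
  exact absurd this (by decide)

theorem aux_max {A M : Type*} [CommRing A] [AddCommGroup M] [Module A M]
    (hI : Order.krullDim (Submodule A M) = 2) (x : M)
    (hx : Submodule.span A {x} ≠ ⊤) (h0 : x ≠ 0) : (Ideal.torsionOf A M x).IsMaximal := by
  rw [Ideal.isMaximal_iff]
  refine ⟨by simpa using h0, fun J a hJ ha haJ => ?_⟩
  obtain ⟨r, hr⟩ := aux_chain hI x hx a (by simpa using ha)
  have : 1 - r * a ∈ J := hJ (by simp [sub_smul, mul_smul, hr])
  have h2 := J.add_mem this (J.mul_mem_left r haJ)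
  simpa using h2

/-- Algebraic formulation of Lemma 3.8: let `A` be a commutative Artinian ring such
that for every maximal ideal `m` of `A`, the socle of the localization `A_m` (the
annihilator of the maximal ideal of `A_m`) is a simple `A_m`-module.  Then every ideal
of `A` of length `2` (length = supremum of lengths of chains of submodules, i.e. the
Krull dimension of the submodule lattice) is principal. -/
theorem ideal_length_two_isPrincipal_of_gorenstein_localizations
    {A : Type*} [CommRing A] [IsArtinianRing A]
    (h : ∀ (m : Ideal A) (hm : m.IsMaximal),
      haveI := hm.isPrime
      IsSimpleModule (Localization.AtPrime m)
        ↥(Submodule.colon (⊥ : Ideal (Localization.AtPrime m))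
          (IsLocalRing.maximalIdeal (Localization.AtPrime m))))
    (I : Ideal A) (hI : Order.krullDim (Submodule A ↥I) = 2) :
    Submodule.IsPrincipal I := by
  by_contra hnp
  have hns : ∀ x : I, Submodule.span A {x} ≠ ⊤ := by
    intro x hx
    apply hnp
    refine ⟨⟨(x : A), ?_⟩⟩
    have := congrArg (Submodule.map I.subtype) hx
    simpa [Submodule.map_span] using this.symm
  have hnt : ∃ x : I, x ≠ 0 := by
    by_contra hc
    push Not at hc
    exact hns 0 (by rw [eq_top_iff]; intro z _; rw [hc z]; exact zero_mem _)
  obtain ⟨x, hx0⟩ := hnt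
  obtain ⟨y, hy⟩ : ∃ y, y ∉ Submodule.span A {x} := by
    by_contra hc
    push Not at hc
    exact hns x (by rw [eq_top_iff]; intro z _; exact hc z)
  have hy0 : y ≠ 0 := by rintro rfl; exact hy (zero_mem _)
  have hmx := aux_max hI x (hns x) hx0
  have hmy := aux_max hI y (hns y) hy0
  have hyx : ∀ a b : A, a • y = b • x → a • y = 0 := by
    intro a b hab
    by_contra h0
    obtain ⟨r, hr⟩ := aux_chain hI y (hns y) a h0
    apply hy
    rw [Submodule.mem_span_singleton]
    exact ⟨r * b, by rw [mul_smul, ← hab, hr]⟩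
  by_cases hmn : Ideal.torsionOf A I x = Ideal.torsionOf A I y
  · have := hmx.isPrime
    have hs := h _ hmx
    set m := Ideal.torsionOf A I x with hm
    let L := Localization.AtPrime m
    have key : ∀ z : I, Ideal.torsionOf A I z = m →
        algebraMap A L z ∈ Submodule.colon (⊥ : Ideal L) (IsLocalRing.maximalIdeal L) := by
      intro z hz
      rw [Submodule.mem_colon]
      intro p hp
      rw [SetLike.mem_coe, ← Localization.AtPrime.map_eq_maximalIdeal] at hp
      rw [Submodule.mem_bot, smul_eq_mul]
      refine Submodule.span_induction ?_ ?_ ?_ ?_ hp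
      · rintro _ ⟨a, ha, rfl⟩
        have ha' : a ∈ Ideal.torsionOf A I z := by rw [hz]; exact ha
        rw [Ideal.mem_torsionOf_iff] at ha'
        have : a * (z : A) = 0 := congrArg Subtype.val ha'
        rw [← map_mul, mul_comm, this, map_zero]
      · simp
      · intro a b _ _ ha hb
        rw [mul_add, ha, hb, add_zero]
      · intro a b _ hb
        rw [smul_eq_mul, mul_left_comm, hb, mul_zero]
    have hx1 : algebraMap A L x ≠ 0 := by
      intro h0
      rw [IsLocalization.map_eq_zero_iff m.primeCompl] at h0
      obtain ⟨t, ht⟩ := h0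
      apply t.2
      change (t : A) ∈ m
      exact (Ideal.mem_torsionOf_iff x (t : A)).mpr (Subtype.ext ht)
    obtain ⟨q, hq⟩ := Submodule.mem_span_singleton.mp
      ((IsSimpleModule.span_singleton_eq_top L
        (m := (⟨_, key x rfl⟩ : Submodule.colon (⊥ : Ideal L) (IsLocalRing.maximalIdeal L)))
        (fun h0 => hx1 (congrArg Subtype.val h0))).ge
        (Submodule.mem_top (x := ⟨_, key y hmn.symm⟩)))
    have hq' : q * algebraMap A L x = algebraMap A L y := congrArg Subtype.val hq
    obtain ⟨a, s, rfl⟩ := IsLocalization.exists_mk'_eq m.primeCompl q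
    have h3 : algebraMap A L (a * x) = algebraMap A L (s * y) := by
      rw [map_mul, map_mul, ← hq', ← mul_assoc, IsLocalization.mk'_spec' ]
    rw [IsLocalization.eq_iff_exists m.primeCompl] at h3
    obtain ⟨t, ht⟩ := h3
    have h4 := hyx (t * s) (t * a) (Subtype.ext (by
      simp only [Submodule.coe_smul, smul_eq_mul]
      rw [mul_assoc, mul_assoc, ht]))
    rw [← Ideal.mem_torsionOf_iff, ← hmn] at h4
    exact (t * s).2 h4
  · obtain ⟨a, ha, b, hb, hab⟩ : ∃ a ∈ Ideal.torsionOf A I x, ∃ b ∈ Ideal.torsionOf A I y,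
        a + b = 1 := by
      have := hmx.coprime_of_ne hmy hmn
      rw [Ideal.eq_top_iff_one, Submodule.mem_sup] at this
      exact this
    rw [Ideal.mem_torsionOf_iff] at ha hb
    have hay : a • y = y := by
      have := congrArg (fun c => c • y) hab
      simpa [add_smul, hb] using this
    have hbx : b • x = x := by
      have := congrArg (fun c => c • x) hab
      simpa [add_smul, ha] using this
    have e1 : a • (x + y) = y := by rw [smul_add, ha, hay, zero_add]
    have e2 : b • (x + y) = x := by rw [smul_add, hb, hbx, add_zero]
    obtain ⟨r, hr⟩ := aux_chain hI (x + y) (hns _) b (by rw [e2]; exact hx0)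
    rw [e2] at hr
    apply hy
    rw [Submodule.mem_span_singleton]
    exact ⟨a * r, by rw [mul_smul, hr, e1]⟩
end
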